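/- arXiv:1801.05848 — 3 statements merged into one kernel-verified Lean document; each statement's English description precedes it below -/
import Mathlib

section
/- Let p be a prime and let F be an algebraic closure of the field with p elements (or of any finite field of characteristic p). Fix integers m ≥ 2, ℓ ≥ 1, s ≥ 1, r_1,…,r_m ≥ 1 with k = mℓ − s ≥ ℓ, R = Σ_{i=1}^m r_i and n = Σ_{i=1}^m (ℓ + r_i). Then there exists a nonzero polynomial P in s·k + ℓ·R variables with coefficients in F such that: (1) for every pair (α, β) ∈ F^{k×s} × F^{ℓ×R-pattern} with P(α, β) ≠ 0, the matrix G(α, β) satisfies the PMDS condition; and (2) there exists at least one pair (α, β) with P(α, β) ≠ 0. In other words, the set A_PMDS of parameter pairs (α, β) over the algebraic closure for which G(α, β) generates a PMDS code is a generic set: it contains a nonempty Zariski-open subset of affine space. -/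
/-- The PMDS condition on a generator matrix `G` whose columns are grouped into `m`
blocks, block `i` having `ℓ + r i` columns: every `k × k` submatrix of `G` formed by
choosing `k` distinct columns, at most `ℓ` of them from each block, is invertible. -/
def PMDSCond (F : Type*) [Field F] {k m : ℕ} (ℓ : ℕ) (r : Fin m → ℕ)
    (G : Matrix (Fin k) ((i : Fin m) × Fin (ℓ + r i)) F) : Prop :=
  ∀ e : Fin k → (i : Fin m) × Fin (ℓ + r i), Function.Injective e →
    (∀ i : Fin m, (Finset.univ.filter (fun b => (e b).1 = i)).card ≤ ℓ) →
    IsUnit (Matrix.det (Matrix.of fun a b => G a (e b)))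

/-- The position, among the `m*ℓ` "local" columns `C_1 | … | C_m` (listed block after
block), of the `t`-th local column of the `i`-th block. -/
def colIdx {m ℓ : ℕ} (i : Fin m) (t : Fin ℓ) : Fin (m * ℓ) :=
  ⟨i.1 * ℓ + t.1, by
    calc i.1 * ℓ + t.1 < i.1 * ℓ + ℓ := by have := t.isLt; omega
      _ = (i.1 + 1) * ℓ := by ring
      _ ≤ m * ℓ := Nat.mul_le_mul_right ℓ i.isLt⟩

/-- Entry `a` of column `colIdx i t` of the `k × (m*ℓ)` matrix `[I_k | α]`,
where `k + s = m * ℓ` and `α ∈ F^{k×s}`. -/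
def stdEntry {F : Type*} [Field F] {m ℓ s k : ℕ} (hk : k + s = m * ℓ)
    (α : Matrix (Fin k) (Fin s) F) (a : Fin k) (i : Fin m) (t : Fin ℓ) : F :=
  if hq : (colIdx i t).1 < k then (if a.1 = (colIdx i t).1 then 1 else 0)
  else α a ⟨(colIdx i t).1 - k, by
    have h1 : (colIdx i t).1 < k + s := lt_of_lt_of_le (colIdx i t).isLt (le_of_eq hk.symm)
    omega⟩

/-- The matrix `G(α, β) = (C_1 | D_1 | … | C_m | D_m)`: the columns `C_1 | … | C_m`
form the matrix `[I_k | α]`, and the `j`-th column of `D_i` is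
`∑_{t} β i j t • C_i^{(t)}`. -/
def Gmat {F : Type*} [Field F] {m ℓ s k : ℕ} (hk : k + s = m * ℓ) (r : Fin m → ℕ)
    (α : Matrix (Fin k) (Fin s) F) (β : (i : Fin m) → Fin (r i) → Fin ℓ → F) :
    Matrix (Fin k) ((i : Fin m) × Fin (ℓ + r i)) F :=
  Matrix.of fun a c =>
    if hc : c.2.1 < ℓ then stdEntry hk α a c.1 ⟨c.2.1, hc⟩
    else ∑ t : Fin ℓ,
      β c.1 ⟨c.2.1 - ℓ, by have := c.2.isLt; omega⟩ t * stdEntry hk α a c.1 t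

/-- A partial injection defined on `s` extends to an injection on all of `u ⊇ s`, provided the
target is large enough. -/
theorem exists_injOn_extending {A B : Type*} [DecidableEq A] [Fintype B] [DecidableEq B]
    (u : Finset A) (hu : u.card ≤ Fintype.card B) (p : A → Prop) [DecidablePred p]
    (f : A → B) (hf : ∀ x ∈ u, ∀ y ∈ u, p x → p y → f x = f y → x = y) :
    ∃ g : A → B, Set.InjOn g u ∧ ∀ x ∈ u, p x → g x = f x := by
  set s : Finset u := Finset.univ.filter (fun x => p x.1) with hs
  have hinj : Set.InjOn (fun x : u => f x.1) s := by
    intro x hx y hy hxy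
    simp only [hs, Finset.coe_filter, Finset.mem_univ, true_and, Set.mem_ofPred_eq] at hx hy
    exact Subtype.ext (hf x.1 x.2 y.1 y.2 hx hy hxy)
  have hcard : (s.image (fun x : u => f x.1)).card ≤ u.card := by
    refine Finset.card_image_le.trans ((Finset.card_le_univ s).trans ?_)
    simp
  obtain ⟨t, hst, -, ht⟩ := Finset.exists_subsuperset_card_eq
    (Finset.subset_univ (s.image (fun x : u => f x.1))) hcard (by simpa using hu)
  obtain ⟨g, hg⟩ := Finset.exists_equiv_extend_of_card_eq (α := u) (t := t)
    (by simpa using ht.symm) hst hinj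
  refine ⟨fun x => if hx : x ∈ u then (g ⟨x, hx⟩ : B) else f x, ?_, ?_⟩
  · intro x hx y hy hxy
    have hx' : x ∈ u := hx
    have hy' : y ∈ u := hy
    simp only [hx', hy', dif_pos] at hxy
    simpa using g.injective (Subtype.ext hxy)
  · intro x hx hpx
    simp only [hx, dif_pos]
    exact hg ⟨x, hx⟩ (by simp [hs, hpx])

theorem colIdx_injective {m ℓ : ℕ} {i i' : Fin m} {t t' : Fin ℓ}
    (h : colIdx i t = colIdx i' t') : i = i' ∧ t = t' := by
  have h1 : t.1 + ℓ * i.1 = t'.1 + ℓ * i'.1 := by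
    have := congrArg Fin.val h
    simp only [colIdx] at this
    linarith [mul_comm ℓ i.1, mul_comm ℓ i'.1]
  have hpos : 0 < ℓ := t.pos
  constructor
  · have := congrArg (· / ℓ) h1
    simp only [Nat.add_mul_div_left _ _ hpos, Nat.div_eq_of_lt t.isLt,
      Nat.div_eq_of_lt t'.isLt, zero_add] at this
    exact Fin.ext this
  · have := congrArg (· % ℓ) h1
    simp only [Nat.add_mul_mod_self_left, Nat.mod_eq_of_lt t.isLt,
      Nat.mod_eq_of_lt t'.isLt] at this
    exact Fin.ext this

/-- Any `k` distinct columns of `[I_k | α]` form a permutation matrix for a suitable `α`. -/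
theorem exists_stdEntry_eq_perm {F : Type*} [Field F] {m ℓ s k : ℕ} (hk : k + s = m * ℓ)
    (q : Fin k → Fin m × Fin ℓ) (hq : Function.Injective q) :
    ∃ (α : Matrix (Fin k) (Fin s) F) (g : Equiv.Perm (Fin k)),
      ∀ a b, stdEntry hk α a (q b).1 (q b).2 = if g b = a then 1 else 0 := by
  classical
  have hc : ∀ b b', (colIdx (q b).1 (q b).2).1 = (colIdx (q b').1 (q b').2).1 → b = b' := by
    intro b b' h
    obtain ⟨h1, h2⟩ := colIdx_injective (Fin.ext h)
    exact hq (Prod.ext h1 h2)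
  obtain ⟨g, hg, hgext⟩ := exists_injOn_extending (Finset.univ : Finset (Fin k)) (by simp)
    (fun b => (colIdx (q b).1 (q b).2).1 < k)
    (fun b => if h : (colIdx (q b).1 (q b).2).1 < k then
      (⟨(colIdx (q b).1 (q b).2).1, h⟩ : Fin k) else b)
    (by
      intro x _ y _ hx hy hxy
      simp only [hx, hy, dif_pos, Fin.mk.injEq] at hxy
      exact hc x y hxy)
  have hginj : Function.Injective g := by simpa [Set.injOn_univ] using hg
  refine ⟨fun a z => if ∃ b, (colIdx (q b).1 (q b).2).1 = k + z.1 ∧ g b = a then 1 else 0,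
    Equiv.ofBijective g (Finite.injective_iff_bijective.mp hginj), ?_⟩
  intro a b
  by_cases h : (colIdx (q b).1 (q b).2).1 < k
  · have hgb := hgext b (Finset.mem_univ b) h
    simp only [h, dif_pos] at hgb
    simp only [stdEntry, h, dif_pos, Equiv.ofBijective_apply, hgb, Fin.ext_iff, eq_comm]
  · simp only [stdEntry, h, dif_neg, not_false_eq_true, Equiv.ofBijective_apply]
    refine if_congr ⟨?_, fun hb => ⟨b, by omega, hb⟩⟩ rfl rfl
    rintro ⟨b', hb', rfl⟩
    rw [hc b b' (by omega)]

/-- Columns of `G` with at most `ℓ` of them in each block coincide, for suitable `β` and all `α`,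
with distinct columns of `[I_k | α]`. -/
theorem exists_Gmat_eq_stdEntry {F : Type*} [Field F] {m ℓ s k : ℕ} (hk : k + s = m * ℓ)
    (r : Fin m → ℕ) (e : Fin k → (i : Fin m) × Fin (ℓ + r i)) (he : Function.Injective e)
    (hcard : ∀ i : Fin m, (Finset.univ.filter (fun b => (e b).1 = i)).card ≤ ℓ) :
    ∃ (β : (i : Fin m) → Fin (r i) → Fin ℓ → F) (q : Fin k → Fin m × Fin ℓ),
      Function.Injective q ∧ ∀ (α : Matrix (Fin k) (Fin s) F) (a b : Fin k),
        Gmat hk r α β a (e b) = stdEntry hk α a (q b).1 (q b).2 := by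
  classical
  have hblock : ∀ i : Fin m, ∃ h : Fin k → Fin ℓ,
      Set.InjOn h (Finset.univ.filter (fun b => (e b).1 = i) : Finset (Fin k)) ∧
      ∀ b, (e b).1 = i → ∀ hb : (e b).2.1 < ℓ, h b = ⟨(e b).2.1, hb⟩ := by
    intro i
    by_cases hne : ∃ b, (e b).1 = i
    swap
    · push Not at hne
      rcases Nat.eq_zero_or_pos ℓ with h0 | h0
      · rcases Nat.eq_zero_or_pos k with hk0 | hk0
        · subst hk0
          exact ⟨fun b => b.elim0, fun b => b.elim0, fun b => b.elim0⟩
        · subst h0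
          simp at hk
          omega
      · exact ⟨fun _ => ⟨0, h0⟩, fun x hx => absurd (by simpa using hx) (hne x),
          fun b hb => absurd hb (hne b)⟩
    obtain ⟨b₀, hb₀⟩ := hne
    have hpos : 0 < ℓ := (Finset.card_pos.mpr ⟨b₀, by simp [hb₀]⟩).trans_le (hcard i)
    obtain ⟨h, hinj, hext⟩ := exists_injOn_extending
      (Finset.univ.filter (fun b => (e b).1 = i)) (by simpa using hcard i)
      (fun b => (e b).2.1 < ℓ)
      (fun b => if hb : (e b).2.1 < ℓ then (⟨(e b).2.1, hb⟩ : Fin ℓ) else ⟨0, hpos⟩)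
      (by
        intro x hx y hy hxl hyl hxy
        simp only [hxl, hyl, dif_pos, Fin.mk.injEq] at hxy
        simp only [Finset.mem_filter, Finset.mem_univ, true_and] at hx hy
        have h1 : (e x).1 = (e y).1 := hx.trans hy.symm
        refine he (Sigma.ext h1 ?_)
        exact (Fin.heq_ext_iff (by rw [h1])).mpr hxy)
    refine ⟨h, hinj, fun b hb hbl => ?_⟩
    rw [hext b (by simp [hb]) hbl, dif_pos hbl]
  choose h hinj hext using hblock
  refine ⟨fun i j t => if ∃ b, e b = ⟨i, Fin.natAdd ℓ j⟩ ∧ h i b = t then 1 else 0,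
    fun b => ((e b).1, h (e b).1 b), ?_, ?_⟩
  · intro x y hxy
    obtain ⟨h1, h2⟩ := Prod.ext_iff.mp hxy
    simp only at h1 h2
    rw [h1] at h2
    exact hinj (e y).1 (by simp [h1]) (by simp) h2
  · intro α a b
    by_cases hb : (e b).2.1 < ℓ
    · simp only [Gmat, Matrix.of_apply, hb, dif_pos, hext _ b rfl hb]
    · simp only [Gmat, Matrix.of_apply, hb, dif_neg, not_false_eq_true]
      rw [Finset.sum_eq_single (h (e b).1 b)]
      · rw [if_pos, one_mul]
        refine ⟨b, Sigma.ext rfl (heq_of_eq (Fin.ext ?_)), rfl⟩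
        simp only [Fin.val_natAdd]
        omega
      · intro t _ ht
        rw [if_neg, zero_mul]
        rintro ⟨b', hb', rfl⟩
        refine ht ?_
        have : b' = b := by
          refine he (hb'.trans (Sigma.ext rfl (heq_of_eq (Fin.ext ?_))))
          simp only [Fin.val_natAdd]
          omega
        rw [this]
      · simp

/-- Every maximal minor occurring in the PMDS condition is nonzero for some parameters. -/
theorem exists_det_Gmat_ne_zero {F : Type*} [Field F] {m ℓ s k : ℕ} (hk : k + s = m * ℓ)
    (r : Fin m → ℕ) (e : Fin k → (i : Fin m) × Fin (ℓ + r i)) (he : Function.Injective e)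
    (hcard : ∀ i : Fin m, (Finset.univ.filter (fun b => (e b).1 = i)).card ≤ ℓ) :
    ∃ (α : Matrix (Fin k) (Fin s) F) (β : (i : Fin m) → Fin (r i) → Fin ℓ → F),
      (Matrix.of fun a b => Gmat hk r α β a (e b)).det ≠ 0 := by
  obtain ⟨β, q, hq, hG⟩ := exists_Gmat_eq_stdEntry (F := F) hk r e he hcard
  obtain ⟨α, g, hα⟩ := exists_stdEntry_eq_perm (F := F) hk q hq
  refine ⟨α, β, ?_⟩
  have hM : (Matrix.of fun a b => Gmat hk r α β a (e b)) = (g.permMatrix F).transpose := by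
    ext a b
    simp [hG, hα, Equiv.Perm.permMatrix, PEquiv.toMatrix_apply, Equiv.toPEquiv_apply, eq_comm]
  rw [hM, Matrix.det_transpose, Matrix.det_permutation]
  rcases Int.units_eq_one_or (Equiv.Perm.sign g) with h | h <;> simp [h]

/-- The entries of `Gmat` are polynomial functions of the parameters. -/
theorem exists_polynomial_Gmat {F : Type*} [Field F] {m ℓ s k : ℕ} (hk : k + s = m * ℓ)
    (r : Fin m → ℕ) (a : Fin k) (c : (i : Fin m) × Fin (ℓ + r i)) :
    ∃ Q : MvPolynomial ((Fin k × Fin s) ⊕ ((i : Fin m) × (Fin (r i) × Fin ℓ))) F,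
      ∀ (α : Matrix (Fin k) (Fin s) F) (β : (i : Fin m) → Fin (r i) → Fin ℓ → F),
        MvPolynomial.eval
          (Sum.elim (fun az => α az.1 az.2) (fun w => β w.1 w.2.1 w.2.2)) Q =
            Gmat hk r α β a c := by
  have hstd : ∀ (i : Fin m) (t : Fin ℓ),
      ∃ Q : MvPolynomial ((Fin k × Fin s) ⊕ ((i : Fin m) × (Fin (r i) × Fin ℓ))) F,
        ∀ (α : Matrix (Fin k) (Fin s) F) (β : (i : Fin m) → Fin (r i) → Fin ℓ → F),
          MvPolynomial.eval
            (Sum.elim (fun az => α az.1 az.2) (fun w => β w.1 w.2.1 w.2.2)) Q =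
              stdEntry hk α a i t := by
    intro i t
    by_cases hq : (colIdx i t).1 < k
    · refine ⟨MvPolynomial.C (if a.1 = (colIdx i t).1 then 1 else 0), fun α β => ?_⟩
      simp only [stdEntry, hq, dif_pos, MvPolynomial.eval_C]
    · refine ⟨MvPolynomial.X (Sum.inl (a, ⟨(colIdx i t).1 - k, by
        have := (colIdx i t).isLt
        omega⟩)), fun α β => ?_⟩
      simp only [stdEntry, hq, dif_neg, not_false_eq_true, MvPolynomial.eval_X, Sum.elim_inl]
  choose Q hQ using hstd
  by_cases hc : c.2.1 < ℓ
  · refine ⟨Q c.1 ⟨c.2.1, hc⟩, fun α β => ?_⟩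
    simp only [hQ, Gmat, Matrix.of_apply, hc, dif_pos]
  · refine ⟨∑ t, MvPolynomial.X (Sum.inr ⟨c.1, ⟨c.2.1 - ℓ, by
      have := c.2.isLt
      omega⟩, t⟩) * Q c.1 t, fun α β => ?_⟩
    simp only [map_sum, map_mul, MvPolynomial.eval_X, Sum.elim_inr, hQ, Gmat, Matrix.of_apply,
      hc, dif_neg, not_false_eq_true]

/-- Over the algebraic closure of `𝔽_p`, the set `A_PMDS` of parameter
pairs `(α, β)` for which `G(α, β)` generates a PMDS code is a generic set: there is a
nonzero polynomial `P` in `s·k + ℓ·R` variables whose nonvanishing at `(α, β)` implies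
the PMDS condition for `G(α, β)`, and which is nonzero at at least one pair `(α, β)`. -/
theorem pmds_generic_over_algebraic_closure (p : ℕ) [Fact p.Prime]
    (m ℓ s k : ℕ) (r : Fin m → ℕ)
    (hm : 2 ≤ m) (hℓ : 1 ≤ ℓ) (hs : 1 ≤ s) (hr : ∀ i, 1 ≤ r i)
    (hk : k + s = m * ℓ) (hℓk : ℓ ≤ k) :
    ∃ P : MvPolynomial ((Fin k × Fin s) ⊕ ((i : Fin m) × (Fin (r i) × Fin ℓ)))
        (AlgebraicClosure (ZMod p)),
      P ≠ 0 ∧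
      (∀ (α : Matrix (Fin k) (Fin s) (AlgebraicClosure (ZMod p)))
          (β : (i : Fin m) → Fin (r i) → Fin ℓ → AlgebraicClosure (ZMod p)),
        MvPolynomial.eval
            (Sum.elim (fun az => α az.1 az.2) (fun w => β w.1 w.2.1 w.2.2)) P ≠ 0 →
          PMDSCond (AlgebraicClosure (ZMod p)) ℓ r (Gmat hk r α β)) ∧
      (∃ (α : Matrix (Fin k) (Fin s) (AlgebraicClosure (ZMod p)))
          (β : (i : Fin m) → Fin (r i) → Fin ℓ → AlgebraicClosure (ZMod p)),
        MvPolynomial.eval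
            (Sum.elim (fun az => α az.1 az.2) (fun w => β w.1 w.2.1 w.2.2)) P ≠ 0) := by
  classical
  choose Q hQ using exists_polynomial_Gmat (F := AlgebraicClosure (ZMod p)) hk r
  let D (e : Fin k → (i : Fin m) × Fin (ℓ + r i)) := (Matrix.of fun a b => Q a (e b)).det
  have hD : ∀ e α β, MvPolynomial.eval
      (Sum.elim (fun az => α az.1 az.2) (fun w => β w.1 w.2.1 w.2.2)) (D e) =
        (Matrix.of fun a b => Gmat hk r α β a (e b)).det := by
    intro e α β
    rw [RingHom.map_det]
    congr 1
    ext a b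
    simp [hQ]
  let E := Finset.univ.filter fun e : Fin k → (i : Fin m) × Fin (ℓ + r i) =>
    Function.Injective e ∧
      ∀ i : Fin m, (Finset.univ.filter (fun b => (e b).1 = i)).card ≤ ℓ
  have hP : ∏ e ∈ E, D e ≠ 0 := by
    refine Finset.prod_ne_zero_iff.mpr fun e he h0 => ?_
    obtain ⟨he, hcard⟩ := (Finset.mem_filter.mp he).2
    obtain ⟨α, β, hαβ⟩ :=
      exists_det_Gmat_ne_zero (F := AlgebraicClosure (ZMod p)) hk r e he hcard
    rw [← hD, h0, map_zero] at hαβ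
    exact hαβ rfl
  refine ⟨∏ e ∈ E, D e, hP, fun α β h e he hcard => ?_, ?_⟩
  · rw [map_prod, Finset.prod_ne_zero_iff] at h
    rw [isUnit_iff_ne_zero, ← hD]
    exact h e (Finset.mem_filter.mpr ⟨Finset.mem_univ e, he, hcard⟩)
  · by_contra! h
    refine hP (MvPolynomial.funext fun x => ?_)
    rw [map_zero, ← h (fun a z => x (Sum.inl (a, z))) (fun i j t => x (Sum.inr ⟨i, j, t⟩))]
    congr 2
    ext (_ | _) <;> rfl
end

section
/- Let F be a finite field with q elements. Fix integers m ≥ 2, ℓ ≥ 1, s ≥ 1, r_1,…,r_m ≥ 1 with k = mℓ − s ≥ ℓ, R = Σ_{i=1}^m r_i and n = Σ_{i=1}^m (ℓ + r_i). Then the number of parameter pairs (α, β), with α ∈ F^{k×s} and β = (β_{t,i,j})_{1≤t≤ℓ, 1≤i≤m, 1≤j≤r_i}, for which the matrix G(α, β) satisfies the PMDS condition is at least q^{sk+ℓR} − 2(n − k)·binom(n−1, k−1)·q^{sk+ℓR−1} (as integers). Equivalently, if α and β are chosen uniformly and independently at random from F, then the probability that the row space of G(α, β) is an [n, k, ℓ;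 r_1,…,r_m]-PMDS code is at least 1 − 2(n − k)·binom(n−1, k−1)/q. -/
/-- An injective partial map between finite types, the source being no larger than the target,
extends to an injective map. -/
lemma exists_injective_extend {α β : Type*} [Fintype α] [Fintype β]
    (h : Fintype.card α ≤ Fintype.card β) (s : Set α) (f : α → β) (hf : Set.InjOn f s) :
    ∃ g : α → β, Function.Injective g ∧ ∀ a ∈ s, g a = f a := by
  classical
  have hs : (s.toFinset.image f).card ≤ Fintype.card α :=
    Finset.card_image_le.trans (Finset.card_le_univ _)
  obtain ⟨t, hst, -, ht⟩ := Finset.exists_subsuperset_card_eq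
    (Finset.subset_univ (s.toFinset.image f)) hs (by simpa using h)
  obtain ⟨g, hg⟩ := Finset.exists_equiv_extend_of_card_eq ht.symm hst (by simpa using hf)
  exact ⟨fun a => g a, Subtype.val_injective.comp g.injective, fun a ha => hg a (by simpa using ha)⟩

/-- `f` is a polynomial function of total degree at most `d`. -/
def IsPolyOfDegreeLE {σ F : Type*} [CommSemiring F] (f : (σ → F) → F) (d : ℕ) : Prop :=
  ∃ p : MvPolynomial σ F, p.totalDegree ≤ d ∧ ∀ x, MvPolynomial.eval x p = f x

namespace IsPolyOfDegreeLE

variable {σ F : Type*}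

lemma const [CommSemiring F] (c : F) (d : ℕ) :
    IsPolyOfDegreeLE (fun _ : σ → F => c) d :=
  ⟨MvPolynomial.C c, by simp, by simp⟩

lemma coord [CommRing F] [Nontrivial F] (i : σ) :
    IsPolyOfDegreeLE (fun x : σ → F => x i) 1 :=
  ⟨MvPolynomial.X i, by simp, by simp⟩

lemma mono [CommSemiring F] {f : (σ → F) → F} {d d' : ℕ} (hf : IsPolyOfDegreeLE f d)
    (h : d ≤ d') : IsPolyOfDegreeLE f d' := by
  obtain ⟨p, hp, hpf⟩ := hf
  exact ⟨p, hp.trans h, hpf⟩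

lemma mul [CommSemiring F] {f g : (σ → F) → F} {d d' : ℕ} (hf : IsPolyOfDegreeLE f d)
    (hg : IsPolyOfDegreeLE g d') : IsPolyOfDegreeLE (fun x => f x * g x) (d + d') := by
  obtain ⟨p, hp, hpf⟩ := hf
  obtain ⟨p', hp', hpf'⟩ := hg
  exact ⟨p * p', (MvPolynomial.totalDegree_mul _ _).trans (add_le_add hp hp'),
    fun x => by simp [hpf, hpf']⟩

lemma sum [CommSemiring F] {ι : Type*} (s : Finset ι) {f : ι → (σ → F) → F} {d : ℕ}
    (hf : ∀ i, IsPolyOfDegreeLE (f i) d) : IsPolyOfDegreeLE (fun x => ∑ i ∈ s, f i x) d := by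
  choose p hp hpf using hf
  exact ⟨∑ i ∈ s, p i, MvPolynomial.totalDegree_finsetSum_le fun i _ => hp i,
    fun x => by simp [hpf]⟩

lemma prod [CommSemiring F] {ι : Type*} (s : Finset ι) {f : ι → (σ → F) → F} {d : ι → ℕ}
    (hf : ∀ i, IsPolyOfDegreeLE (f i) (d i)) :
    IsPolyOfDegreeLE (fun x => ∏ i ∈ s, f i x) (∑ i ∈ s, d i) := by
  choose p hp hpf using hf
  exact ⟨∏ i ∈ s, p i,
    (MvPolynomial.totalDegree_finsetProd _ _).trans (Finset.sum_le_sum fun i _ => hp i),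
    fun x => by simp [hpf]⟩

/-- A determinant whose column `b` has polynomial entries of degree at most `d b` is polynomial
of degree at most `∑ b, d b`. -/
lemma det [CommRing F] {n : Type*} [Fintype n] [DecidableEq n] {M : (σ → F) → Matrix n n F}
    {d : n → ℕ} (hM : ∀ a b, IsPolyOfDegreeLE (fun x => M x a b) (d b)) :
    IsPolyOfDegreeLE (fun x => (M x).det) (∑ b, d b) := by
  simp only [Matrix.det_apply']
  refine sum _ fun τ => ?_
  exact ((const _ 0).mul (prod _ fun b => hM (τ b) b)).mono (by simp)

/-- **Schwartz–Zippel** for a polynomial function over a finite field. -/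
lemma card_zeros_le [Field F] [Fintype F] [DecidableEq F] [Fintype σ] [DecidableEq σ]
    {f : (σ → F) → F} {d : ℕ}
    (hf : IsPolyOfDegreeLE f d) (h0 : ∃ x, f x ≠ 0) (hσ : 1 ≤ Fintype.card σ) :
    (Finset.univ.filter fun x => f x = 0).card ≤
      d * Fintype.card F ^ (Fintype.card σ - 1) := by
  obtain ⟨p, hp, hpf⟩ := hf
  obtain ⟨x₀, hx₀⟩ := h0
  let ε := Fintype.equivFin σ
  have hev : ∀ y : Fin (Fintype.card σ) → F,
      MvPolynomial.eval y (MvPolynomial.rename ε p) = f (y ∘ ε) := fun y => by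
    rw [MvPolynomial.eval_rename, hpf]
  have hne : MvPolynomial.rename ε p ≠ 0 := fun h => hx₀ <| by
    have := hev (x₀ ∘ ε.symm)
    rw [h] at this
    simpa [Function.comp_assoc] using this.symm
  have key := MvPolynomial.schwartz_zippel_totalDegree hne (Finset.univ : Finset F)
  have hcard : (Finset.univ.filter fun x => f x = 0).card =
      (((Fintype.piFinset fun _ => (Finset.univ : Finset F)).filter
        fun y : Fin (Fintype.card σ) → F =>
          MvPolynomial.eval y (MvPolynomial.rename ε p) = 0)).card := by
    refine Finset.card_bij' (fun x _ => x ∘ ε.symm) (fun y _ => y ∘ ε) ?_ ?_ ?_ ?_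
    · intro x hx
      simpa [hev, Function.comp_assoc] using hx
    · intro y hy
      simpa [hev] using hy
    · intro x _; simp [Function.comp_assoc]
    · intro y _; simp [Function.comp_assoc]
  rw [← hcard, Finset.card_univ] at key
  have hq : (0 : ℚ≥0) < Fintype.card F := by exact_mod_cast Fintype.card_pos
  obtain ⟨N, hN⟩ : ∃ N, Fintype.card σ = N + 1 := ⟨_, (Nat.sub_add_cancel hσ).symm⟩
  have hd : ((MvPolynomial.rename ε p).totalDegree : ℚ≥0) ≤ d := by
    exact_mod_cast (MvPolynomial.totalDegree_rename_le _ _).trans hp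
  have key' := key.trans (div_le_div_of_nonneg_right hd hq.le)
  rw [div_le_div_iff₀ (by positivity) hq, hN, pow_succ, ← mul_assoc] at key'
  have := le_of_mul_le_mul_right key' hq
  rw [hN, Nat.add_sub_cancel]
  exact_mod_cast this

end IsPolyOfDegreeLE

/-- Double counting of the pairs `c ∈ S` with `c ∈ T` and `S` a `k`-subset of `α`. -/
lemma sum_card_inter_powersetCard {α : Type*} [Fintype α] [DecidableEq α] (T : Finset α)
    {k : ℕ} (hk : 1 ≤ k) :
    ∑ S ∈ Finset.powersetCard k (Finset.univ : Finset α), (S ∩ T).card =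
      T.card * (Fintype.card α - 1).choose (k - 1) := by
  have h (S : Finset α) : (S ∩ T).card = ∑ c ∈ T, if {c} ⊆ S then 1 else 0 := by
    simp [Finset.inter_comm]
  simp_rw [h]
  rw [Finset.sum_comm, ← smul_eq_mul, ← Finset.sum_const]
  refine Finset.sum_congr rfl fun c _ => ?_
  rw [← Finset.card_filter, Finset.card_filter_powersetCard_subset _ _ _ (Finset.subset_univ _)
    (by simpa using hk)]
  simp

/-- A family of `k` columns, at most `ℓ` from each block, can be matched injectively with local
columns of the same blocks, each local column of the family being matched with itself. -/
lemma exists_local_matching {m ℓ k : ℕ} {r : Fin m → ℕ} (hℓ : 1 ≤ ℓ)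
    (e : Fin k → (i : Fin m) × Fin (ℓ + r i)) (he : Function.Injective e)
    (hc : ∀ i : Fin m, (Finset.univ.filter (fun b => (e b).1 = i)).card ≤ ℓ) :
    ∃ g : Fin k → Fin ℓ, Function.Injective (fun b => ((e b).1, g b)) ∧
      ∀ b, (e b).2.1 < ℓ → (g b).1 = (e b).2.1 := by
  have hblock (i : Fin m) : ∃ g : {b // (e b).1 = i} → Fin ℓ, Function.Injective g ∧
      ∀ b, (e b.1).2.1 < ℓ → (g b).1 = (e b.1).2.1 := by
    obtain ⟨g, hg, hgf⟩ := exists_injective_extend (α := {b // (e b).1 = i}) (β := Fin ℓ)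
      (by simpa [Fintype.card_subtype] using hc i) {b | (e b.1).2.1 < ℓ}
      (fun b => if h : (e b.1).2.1 < ℓ then ⟨(e b.1).2.1, h⟩ else ⟨0, hℓ⟩) (by
        rintro ⟨a, ha⟩ ha' ⟨b, hb⟩ hb' hab
        simp only [Set.mem_ofPred_eq] at ha' hb'
        simp only [ha', hb', dif_pos, Fin.mk.injEq] at hab
        refine Subtype.ext (he ?_)
        exact Sigma.ext (ha.trans hb.symm) ((Fin.heq_ext_iff (by rw [ha, hb])).2 hab))
    refine ⟨g, hg, fun b hb => ?_⟩
    rw [hgf b hb, dif_pos hb]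
  choose g hg hgf using hblock
  refine ⟨fun b => g (e b).1 ⟨b, rfl⟩, fun a b hab => ?_, fun b hb => hgf _ ⟨b, rfl⟩ hb⟩
  simp only [Prod.mk.injEq] at hab
  obtain ⟨h1, h2⟩ := hab
  have h3 : ∀ i (hi : (e b).1 = i), g (e b).1 ⟨b, rfl⟩ = g i ⟨b, hi⟩ := by
    rintro i rfl; rfl
  rw [h3 _ h1.symm] at h2
  exact congrArg Subtype.val (hg _ h2)

lemma colIdx_injective_s7 {m ℓ : ℕ} :
    Function.Injective (fun p : Fin m × Fin ℓ => colIdx p.1 p.2) := by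
  rintro ⟨i, t⟩ ⟨j, u⟩ h
  apply finProdFinEquiv.injective
  have h' := congrArg Fin.val h
  simp only [colIdx] at h'
  apply Fin.ext
  simp only [finProdFinEquiv_apply_val]
  lia

/-- Every admissible minor of `G(α, β)` is non-zero for some choice of the parameters. -/
lemma exists_det_ne_zero {F : Type*} [Field F] {m ℓ s k : ℕ} (hℓ : 1 ≤ ℓ) (hk : k + s = m * ℓ)
    {r : Fin m → ℕ} (e : Fin k → (i : Fin m) × Fin (ℓ + r i)) (he : Function.Injective e)
    (hc : ∀ i : Fin m, (Finset.univ.filter (fun b => (e b).1 = i)).card ≤ ℓ) :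
    ∃ (α : Matrix (Fin k) (Fin s) F) (β : (i : Fin m) → Fin (r i) → Fin ℓ → F),
      (Matrix.of fun a b => Gmat hk r α β a (e b)).det ≠ 0 := by
  classical
  obtain ⟨g, hg, hgl⟩ := exists_local_matching hℓ e he hc
  let h : Fin k → Fin (m * ℓ) := fun b => colIdx (e b).1 (g b)
  have hinj : Function.Injective h := colIdx_injective_s7.comp hg
  obtain ⟨π, hπ, hπh⟩ := exists_injective_extend (α := Fin k) (β := Fin k) le_rfl
    {b | (h b).1 < k} (fun b => if hb : (h b).1 < k then ⟨(h b).1, hb⟩ else b) (by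
      intro a ha b hb hab
      simp only [Set.mem_ofPred_eq] at ha hb
      simp only [ha, hb, dif_pos, Fin.mk.injEq] at hab
      exact hinj (Fin.ext hab))
  let α : Matrix (Fin k) (Fin s) F := Matrix.of fun a j =>
    if ∃ b, (h b).1 = k + j.1 ∧ π b = a then 1 else 0
  let β : (i : Fin m) → Fin (r i) → Fin ℓ → F := fun i j t =>
    if ∃ b, e b = ⟨i, Fin.natAdd ℓ j⟩ ∧ g b = t then 1 else 0
  have hstd (a b : Fin k) : stdEntry hk α a (e b).1 (g b) = if a = π b then 1 else 0 := by
    unfold stdEntry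
    by_cases h1 : (h b).1 < k
    · have h2 : (π b).1 = (colIdx (e b).1 (g b)).1 := by
        rw [hπh b h1]; simp only [h, h1, dif_pos]
      rw [dif_pos h1]
      simp only [Fin.ext_iff, h2]
    · rw [dif_neg h1]
      by_cases h3 : a = π b
      · rw [if_pos h3]
        refine if_pos ⟨b, ?_, h3.symm⟩
        simp only [h] at h1 ⊢; lia
      · rw [if_neg h3]
        refine if_neg ?_
        rintro ⟨b', hb', rfl⟩
        refine h3 (congrArg π (hinj (Fin.ext ?_)))
        simp only [h] at h1 hb' ⊢; lia
  have hentry (a b : Fin k) : Gmat hk r α β a (e b) = if a = π b then 1 else 0 := by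
    rw [← hstd]
    simp only [Gmat, Matrix.of_apply]
    split_ifs with h1
    · congr 1
      exact Fin.ext (hgl b h1).symm
    · rw [Finset.sum_eq_single (g b)]
      · have : β (e b).1 ⟨(e b).2.1 - ℓ, by have := (e b).2.isLt; omega⟩ (g b) = 1 :=
          if_pos ⟨b, Sigma.ext rfl (heq_of_eq (Fin.ext (by simp; lia))), rfl⟩
        rw [this, one_mul]
      · intro t _ ht
        have : β (e b).1 ⟨(e b).2.1 - ℓ, by have := (e b).2.isLt; omega⟩ t = 0 := by
          refine if_neg ?_
          rintro ⟨b', hb', rfl⟩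
          refine ht (congrArg g (he (hb'.trans ?_)))
          exact Sigma.ext rfl (heq_of_eq (Fin.ext (by simp; lia)))
        rw [this, zero_mul]
      · simp
  refine ⟨α, β, ?_⟩
  let τ : Equiv.Perm (Fin k) := Equiv.ofBijective π (Finite.injective_iff_bijective.1 hπ)
  have hM : (Matrix.of fun a b => Gmat hk r α β a (e b)) =
      (1 : Matrix (Fin k) (Fin k) F).submatrix id τ := by
    ext a b
    simp [hentry, Matrix.one_apply, τ]
  rw [hM, Matrix.det_permute']
  rcases Int.units_eq_one_or (Equiv.Perm.sign τ) with h | h <;> simp [h]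

/-- The indices of the parameters: entries of `α` and entries of `β`. -/
abbrev ParamIdx {m : ℕ} (ℓ s k : ℕ) (r : Fin m → ℕ) : Type :=
  (Fin k × Fin s) ⊕ ((i : Fin m) × (Fin (r i) × Fin ℓ))

/-- The pair `(α, β)` with a given flat list of entries. -/
def paramEquiv (F : Type*) {m : ℕ} (ℓ s k : ℕ) (r : Fin m → ℕ) :
    (ParamIdx ℓ s k r → F) ≃
      Matrix (Fin k) (Fin s) F × ((i : Fin m) → Fin (r i) → Fin ℓ → F) where
  toFun x := (Matrix.of fun a j => x (.inl (a, j)), fun i j t => x (.inr ⟨i, (j, t)⟩))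
  invFun y := Sum.elim (fun p => y.1 p.1 p.2) (fun p => y.2 p.1 p.2.1 p.2.2)
  left_inv x := by ext (_ | _) <;> rfl
  right_inv y := rfl

/-- The column `c` of `G(α, β)` is a column of the identity matrix. -/
def IsUnitCol {m ℓ : ℕ} {r : Fin m → ℕ} (k : ℕ) (c : (i : Fin m) × Fin (ℓ + r i)) : Prop :=
  c.2.1 < ℓ ∧ c.1.1 * ℓ + c.2.1 < k

instance {m ℓ : ℕ} {r : Fin m → ℕ} (k : ℕ) :
    DecidablePred (IsUnitCol (m := m) (ℓ := ℓ) (r := r) k) :=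
  fun _ => inferInstanceAs (Decidable (_ ∧ _))

lemma isPolyOfDegreeLE_stdEntry {F : Type*} [Field F] {m ℓ s k : ℕ} (hk : k + s = m * ℓ)
    (r : Fin m → ℕ) (a : Fin k) (i : Fin m) (t : Fin ℓ) :
    IsPolyOfDegreeLE (fun x => stdEntry hk (paramEquiv F ℓ s k r x).1 a i t)
      (if (colIdx i t).1 < k then 0 else 1) := by
  unfold stdEntry
  split_ifs
  · exact .const _ _
  · exact .const _ _
  · exact .coord _

lemma isPolyOfDegreeLE_Gmat {F : Type*} [Field F] {m ℓ s k : ℕ} (hk : k + s = m * ℓ)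
    (r : Fin m → ℕ) (a : Fin k) (c : (i : Fin m) × Fin (ℓ + r i)) :
    IsPolyOfDegreeLE (fun x => Gmat hk r (paramEquiv F ℓ s k r x).1 (paramEquiv F ℓ s k r x).2 a c)
      (if IsUnitCol k c then 0 else 2) := by
  by_cases hc : c.2.1 < ℓ
  · simp only [Gmat, Matrix.of_apply, hc, dif_pos]
    refine (isPolyOfDegreeLE_stdEntry hk r a c.1 ⟨c.2.1, hc⟩).mono ?_
    split_ifs with h1 h2 h2
    · exact le_rfl
    · exact Nat.zero_le _
    · exact absurd h2.2 h1
    · exact one_le_two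
  · simp only [Gmat, Matrix.of_apply, hc, dif_neg, not_false_eq_true]
    rw [if_neg fun h => hc h.1]
    refine .sum _ fun t => ?_
    refine ((IsPolyOfDegreeLE.coord _).mul (isPolyOfDegreeLE_stdEntry hk r a c.1 t)).mono ?_
    split_ifs <;> simp

lemma le_card_isUnitCol {m ℓ s k : ℕ} (hℓ : 1 ≤ ℓ) (hk : k + s = m * ℓ) (r : Fin m → ℕ) :
    k ≤ (Finset.univ.filter fun c : (i : Fin m) × Fin (ℓ + r i) => IsUnitCol k c).card := by
  let f : Fin k → (i : Fin m) × Fin (ℓ + r i) := fun p =>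
    ⟨⟨p.1 / ℓ, (Nat.div_lt_iff_lt_mul hℓ).2 (by have := p.2; lia)⟩,
      ⟨p.1 % ℓ, (Nat.mod_lt _ hℓ).trans_le (Nat.le_add_right _ _)⟩⟩
  have hf (p : Fin k) : (f p).1.1 * ℓ + (f p).2.1 = p.1 := Nat.div_add_mod' p.1 ℓ
  have hinj : Function.Injective f := fun p q hpq => Fin.ext (by rw [← hf p, ← hf q, hpq])
  have hcard := Finset.card_image_of_injective Finset.univ hinj
  rw [Finset.card_fin] at hcard
  refine hcard.ge.trans (Finset.card_le_card fun c hc => ?_)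
  obtain ⟨p, -, rfl⟩ := Finset.mem_image.1 hc
  exact Finset.mem_filter.2 ⟨Finset.mem_univ _, Nat.mod_lt _ hℓ, (hf p).trans_lt p.2⟩

/-- The columns of an admissible `k`-set, listed in some order, give a minor vanishing for few
parameters. -/
lemma card_det_eq_zero_le {F : Type*} [Field F] [Fintype F] [DecidableEq F] {m ℓ s k : ℕ}
    (hℓ : 1 ≤ ℓ) (hk : k + s = m * ℓ) {r : Fin m → ℕ} (hN : 1 ≤ Fintype.card (ParamIdx ℓ s k r))
    (e : Fin k → (i : Fin m) × Fin (ℓ + r i)) (he : Function.Injective e)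
    (hc : ∀ i : Fin m, (Finset.univ.filter (fun b => (e b).1 = i)).card ≤ ℓ) :
    (Finset.univ.filter fun x => (Matrix.of fun a b => Gmat hk r (paramEquiv F ℓ s k r x).1
        (paramEquiv F ℓ s k r x).2 a (e b)).det = 0).card ≤
      2 * (Finset.univ.image e ∩ Finset.univ.filter fun c => ¬ IsUnitCol k c).card *
        Fintype.card F ^ (Fintype.card (ParamIdx ℓ s k r) - 1) := by
  have hd : ∑ b, (if IsUnitCol k (e b) then 0 else 2) =
      2 * (Finset.univ.image e ∩ Finset.univ.filter fun c => ¬ IsUnitCol k c).card := by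
    rw [Finset.inter_filter, Finset.inter_univ, Finset.filter_image,
      Finset.card_image_of_injective _ he, Finset.card_filter, Finset.mul_sum]
    refine Finset.sum_congr rfl fun b _ => ?_
    split_ifs <;> simp
  rw [← hd]
  refine (IsPolyOfDegreeLE.det fun a b => isPolyOfDegreeLE_Gmat hk r a (e b)).card_zeros_le
    ?_ hN
  obtain ⟨α, β, h⟩ := exists_det_ne_zero (F := F) hℓ hk e he hc
  exact ⟨(paramEquiv F ℓ s k r).symm (α, β), by rwa [Equiv.apply_symm_apply]⟩

/-- Whether the minor on given columns vanishes does not depend on their order. -/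
lemma isUnit_det_of_image_eq {F : Type*} [Field F] {k : ℕ} {ι : Type*} [DecidableEq ι]
    (G : Matrix (Fin k) ι F) {e e' : Fin k → ι} (he : Function.Injective e)
    (h : Finset.univ.image e = Finset.univ.image e')
    (hu : (Matrix.of fun a b => G a (e' b)).det ≠ 0) :
    IsUnit (Matrix.of fun a b => G a (e b)).det := by
  have hmem (b : Fin k) : ∃ b', e' b' = e b := by
    have : e b ∈ Finset.univ.image e' := h ▸ Finset.mem_image_of_mem e (Finset.mem_univ b)
    simpa using this
  choose π hπ using hmem
  have hinj : Function.Injective π := fun a b hab => he (by rw [← hπ a, ← hπ b, hab])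
  let τ : Equiv.Perm (Fin k) := Equiv.ofBijective π (Finite.injective_iff_bijective.1 hinj)
  have hM : (Matrix.of fun a b => G a (e b)) =
      (Matrix.of fun a b => G a (e' b)).submatrix id τ := by
    ext a b
    simp [τ, hπ]
  rw [hM, Matrix.det_permute', isUnit_iff_ne_zero]
  rcases Int.units_eq_one_or (Equiv.Perm.sign τ) with h | h <;> simpa [h] using hu

/-- The number of parameters for which the PMDS condition fails. -/
lemma card_not_PMDSCond_le {F : Type*} [Field F] [Fintype F] {m ℓ s k : ℕ} (hℓ : 1 ≤ ℓ)
    (hk1 : 1 ≤ k) (hk : k + s = m * ℓ) {r : Fin m → ℕ}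
    (hN : 1 ≤ Fintype.card (ParamIdx ℓ s k r)) [DecidablePred fun x : ParamIdx ℓ s k r → F =>
      PMDSCond F ℓ r (Gmat hk r (paramEquiv F ℓ s k r x).1 (paramEquiv F ℓ s k r x).2)]
    {n : ℕ} (hn : n = ∑ i, (ℓ + r i)) :
    (Finset.univ.filter fun x : ParamIdx ℓ s k r → F =>
        ¬ PMDSCond F ℓ r (Gmat hk r (paramEquiv F ℓ s k r x).1 (paramEquiv F ℓ s k r x).2)).card ≤
      2 * (n - k) * (n - 1).choose (k - 1) *
        Fintype.card F ^ (Fintype.card (ParamIdx ℓ s k r) - 1) := by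
  classical
  let κ := (i : Fin m) × Fin (ℓ + r i)
  have hκ : Fintype.card κ = n := by simp [κ, hn]
  let T : Finset κ := Finset.univ.filter fun c => ¬ IsUnitCol k c
  have hT : T.card ≤ n - k := by
    have h1 := le_card_isUnitCol hℓ hk r
    have h2 := Finset.card_filter_add_card_filter_not (s := (Finset.univ : Finset κ))
      (fun c : κ => IsUnitCol k c)
    rw [Finset.card_univ, hκ] at h2
    simp only [T, κ] at *
    lia
  let P := Finset.powersetCard k (Finset.univ : Finset κ)
  let Q := P.filter fun S => ∀ i, (S.filter fun c => c.1 = i).card ≤ ℓ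
  have henum (S : Finset κ) : ∃ e : Fin k → κ, S ∈ P →
      Function.Injective e ∧ Finset.univ.image e = S := by
    by_cases hS : S ∈ P
    · have hcard := (Finset.mem_powersetCard.1 hS).2
      let ε := (Finset.equivFinOfCardEq hcard).symm
      refine ⟨fun b => ε b, fun _ => ⟨Subtype.val_injective.comp ε.injective, ?_⟩⟩
      refine Finset.eq_of_subset_of_card_le (fun c hc => ?_) ?_
      · obtain ⟨b, -, rfl⟩ := Finset.mem_image.1 hc
        exact (ε b).2
      · have h := Finset.card_image_of_injective Finset.univ
          (Subtype.val_injective.comp ε.injective)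
        exact (hcard.trans ((Finset.card_fin k).symm.trans h.symm)).le
    · obtain ⟨b⟩ : Nonempty κ := by
        rw [← Fintype.card_pos_iff, hκ, ← hκ]
        exact hk1.trans ((le_card_isUnitCol hℓ hk r).trans (Finset.card_le_univ _))
      exact ⟨fun _ => b, fun h => absurd h hS⟩
  choose e he using henum
  have hcount (e : Fin k → κ) (h : Function.Injective e) (i : Fin m) :
      ((Finset.univ.image e).filter fun c => c.1 = i).card =
        (Finset.univ.filter fun b => (e b).1 = i).card := by
    rw [Finset.filter_image, Finset.card_image_of_injective _ h]
  let Z (S : Finset κ) : Finset (ParamIdx ℓ s k r → F) := Finset.univ.filter fun x =>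
    (Matrix.of fun a b => Gmat hk r (paramEquiv F ℓ s k r x).1
      (paramEquiv F ℓ s k r x).2 a (e S b)).det = 0
  have hZ (S : Finset κ) (hS : S ∈ Q) : (Z S).card ≤ 2 * (S ∩ T).card *
      Fintype.card F ^ (Fintype.card (ParamIdx ℓ s k r) - 1) := by
    obtain ⟨hSP, hSb⟩ := Finset.mem_filter.1 hS
    obtain ⟨hinj, himg⟩ := he S hSP
    have := card_det_eq_zero_le (F := F) hℓ hk hN (e S) hinj fun i => by
      rw [← hcount _ hinj, himg]; exact hSb i
    rwa [himg] at this
  calc _ ≤ (Q.biUnion Z).card := by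
        refine Finset.card_le_card fun x hx => ?_
        have hx' := (Finset.mem_filter.1 hx).2
        contrapose! hx'
        intro f hf hfb
        have hfP : Finset.univ.image f ∈ P := Finset.mem_powersetCard.2
          ⟨Finset.subset_univ _, by rw [Finset.card_image_of_injective _ hf, Finset.card_fin]⟩
        have hfQ : Finset.univ.image f ∈ Q := Finset.mem_filter.2
          ⟨hfP, fun i => by rw [hcount f hf]; exact hfb i⟩
        obtain ⟨hinj, himg⟩ := he _ hfP
        refine isUnit_det_of_image_eq _ hf himg.symm fun h0 => hx' ?_
        exact Finset.mem_biUnion.2 ⟨_, hfQ, Finset.mem_filter.2 ⟨Finset.mem_univ _, h0⟩⟩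
    _ ≤ ∑ S ∈ Q, (Z S).card := Finset.card_biUnion_le
    _ ≤ ∑ S ∈ Q, 2 * (S ∩ T).card *
          Fintype.card F ^ (Fintype.card (ParamIdx ℓ s k r) - 1) := Finset.sum_le_sum hZ
    _ ≤ ∑ S ∈ P, 2 * (S ∩ T).card *
          Fintype.card F ^ (Fintype.card (ParamIdx ℓ s k r) - 1) :=
        Finset.sum_le_sum_of_subset (Finset.filter_subset _ _)
    _ = 2 * (T.card * (n - 1).choose (k - 1)) *
          Fintype.card F ^ (Fintype.card (ParamIdx ℓ s k r) - 1) := by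
        rw [← Finset.sum_mul, ← Finset.mul_sum, sum_card_inter_powersetCard T hk1, hκ]
    _ ≤ _ := by
        rw [← mul_assoc]
        gcongr

/-- If `F` is a finite field with `q` elements, the number of parameter
pairs `(α, β)` for which `G(α, β)` satisfies the PMDS condition is at least
`q^(sk+ℓR) − 2(n−k)·C(n−1, k−1)·q^(sk+ℓR−1)` (as integers); equivalently, random `(α, β)`
give a PMDS code with probability at least `1 − 2(n−k)·C(n−1, k−1)/q`. -/
theorem pmds_random_count (F : Type*) [Field F] [Fintype F]
    (m ℓ s k : ℕ) (r : Fin m → ℕ)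
    (hm : 2 ≤ m) (hℓ : 1 ≤ ℓ) (hs : 1 ≤ s) (hr : ∀ i, 1 ≤ r i)
    (hk : k + s = m * ℓ) (hℓk : ℓ ≤ k)
    (R n : ℕ) (hR : R = ∑ i, r i) (hn : n = ∑ i, (ℓ + r i)) :
    ((Fintype.card F : ℤ) ^ (s * k + ℓ * R)
        - (2 * (n - k) * Nat.choose (n - 1) (k - 1) : ℕ) *
            (Fintype.card F : ℤ) ^ (s * k + ℓ * R - 1))
      ≤ (Nat.card {x : Matrix (Fin k) (Fin s) F ×
            ((i : Fin m) → Fin (r i) → Fin ℓ → F) //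
          PMDSCond F ℓ r (Gmat hk r x.1 x.2)} : ℤ) := by
  classical
  have hk1 : 1 ≤ k := hℓ.trans hℓk
  have hN : Fintype.card (ParamIdx ℓ s k r) = s * k + ℓ * R := by
    simp [hR, Finset.mul_sum, mul_comm]
  have hN1 : 1 ≤ Fintype.card (ParamIdx ℓ s k r) :=
    hN ▸ (Nat.mul_pos hs hk1).trans_le (Nat.le_add_right _ _)
  have hbad := card_not_PMDSCond_le (F := F) hℓ hk1 hk hN1 hn
  have hsplit := Finset.card_filter_add_card_filter_not
    (s := (Finset.univ : Finset (ParamIdx ℓ s k r → F)))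
    (fun x => PMDSCond F ℓ r (Gmat hk r (paramEquiv F ℓ s k r x).1 (paramEquiv F ℓ s k r x).2))
  rw [Finset.card_univ, Fintype.card_fun, hN] at hsplit
  rw [hN] at hbad
  have hgood := Nat.card_congr ((paramEquiv F ℓ s k r).subtypeEquivOfSubtype
    (p := fun y => PMDSCond F ℓ r (Gmat hk r y.1 y.2)))
  rw [Nat.card_eq_fintype_card, Fintype.card_subtype] at hgood
  rw [← hgood, sub_le_iff_le_add]
  exact_mod_cast hsplit.ge.trans (Nat.add_le_add_left hbad _)
end

section
/- Let F be a finite field with |F| > binom(mℓ, k−1), where m ≥ 2, ℓ ≥ 1 and ℓ ≤ k < mℓ are integers. Let G_C = (C_1 | … | C_m) ∈ F^{k×(mℓ)}, with each C_i ∈ F^{k×ℓ}, be a matrix in which every k columns are linearly independent (i.e., G_C generates an [mℓ, k]-MDS code). Then there exist scalars β_1,…,β_ℓ ∈ F such that, setting d = Σ_{t=1}^ℓ β_t C_1^{(t)} (where C_1^{(t)} is the t-th column of C_1) and forming G' = (C_1 | d | C_2 | … | C_m) ∈ F^{k×(mℓ+1)} with blocks B_1 = (C_1 | d) of size ℓ+1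 and B_i = C_i of size ℓ for i ≥ 2, every k×k submatrix of G' using at most ℓ columns from each block is invertible; i.e., the row space of G' is an [mℓ+1, k, ℓ; 1, 0,…,0]-PMDS code. -/
open Finset in
/-- If all `k × k` submatrices of `G` are invertible, then any `k` columns of `G` are linearly
independent. -/
theorem linearIndepOn_col_of_forall_isUnit_det {F ι : Type*} [Field F] {k : ℕ}
    {G : Matrix (Fin k) ι F}
    (hG : ∀ e : Fin k → ι, Function.Injective e →
      IsUnit (Matrix.det (Matrix.of fun a b => G a (e b))))
    (s : Finset ι) (hs : #s = k) : LinearIndepOn F G.col (s : Set ι) := by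
  let f := s.equivFinOfCardEq hs
  have h := hG (fun b => (f.symm b : ι)) (Subtype.val_injective.comp f.symm.injective)
  rw [← Matrix.isUnit_iff_isUnit_det, ← Matrix.linearIndependent_cols_iff_isUnit] at h
  exact (linearIndependent_equiv f.symm).1 h

open Finset in
/-- If any `k` of the vectors `v i` are linearly independent and the field has more than
`(card ι).choose (k - 1)` elements, some linear combination of the `v (c t)` avoids the span of
every `k - 1` of the vectors `v i` which do not comprise all of the `v (c t)`. -/
theorem exists_sum_smul_notMem_span_image {F V ι κ : Type*} [Field F] [AddCommGroup V] [Module F V]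
    [Fintype ι] [DecidableEq ι] [Fintype κ] [DecidableEq κ] {k : ℕ} (hk : 1 ≤ k)
    (hcard : ((Fintype.card ι).choose (k - 1) : ℕ∞) < ENat.card F) (v : ι → V)
    (hv : ∀ s : Finset ι, #s = k → LinearIndepOn F v (s : Set ι)) (c : κ → ι) :
    ∃ β : κ → F, ∀ s : Finset ι, #s = k - 1 → (∃ t, c t ∉ s) →
      ∑ t, β t • v (c t) ∉ Submodule.span F (v '' (s : Set ι)) := by
  let D : (κ → F) →ₗ[F] V := Fintype.linearCombination F (v ∘ c)
  let S := {s : Finset ι // #s = k - 1 ∧ ∃ t, c t ∉ s}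
  let p (s : S) : Submodule F (κ → F) := (Submodule.span F (v '' (s.1 : Set ι))).comap D
  have hp (s : S) : p s ≠ ⊤ := by
    obtain ⟨s, hs, t, ht⟩ := s
    intro htop
    have hmem : Pi.single t (1 : F) ∈ p ⟨s, hs, t, ht⟩ := htop ▸ Submodule.mem_top
    have hind := hv (insert (c t) s) (by rw [card_insert_of_notMem ht]; omega)
    rw [coe_insert, linearIndepOn_insert (by simpa using ht)] at hind
    exact hind.2 (by simpa [p, D, Fintype.linearCombination_apply_single] using hmem)
  have hS : Fintype.card S ≤ (Fintype.card ι).choose (k - 1) := by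
    rw [Fintype.card_subtype, ← card_univ, ← card_powersetCard]
    exact card_le_card fun s hs => by simp_all [mem_powersetCard]
  have hss := Submodule.iUnion_ssubset_of_forall_ne_top_of_card_lt univ p hp
    (lt_of_le_of_lt (by simpa using hS) hcard)
  obtain ⟨β, -, hβ⟩ := Set.exists_of_ssubset hss
  refine ⟨β, fun s hs ht hmem => hβ ?_⟩
  simp only [Set.mem_iUnion]
  exact ⟨⟨s, hs, ht⟩, mem_univ _, by
    simpa [p, D, Fintype.linearCombination_apply] using hmem⟩


/-- The block condition with locality `ℓ` on a matrix `G` whose columns are grouped into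
`m` blocks, block `i` having `nb i` columns: every `k × k` submatrix of `G` formed by
choosing `k` distinct columns, at most `ℓ` of them from each block, is invertible.
For block sizes `nb i = ℓ + r i` this is the PMDS condition for `(ℓ; r_1, …, r_m)`. -/
def BlockCond (F : Type*) [Field F] {k m : ℕ} (ℓ : ℕ) (nb : Fin m → ℕ)
    (G : Matrix (Fin k) ((i : Fin m) × Fin (nb i)) F) : Prop :=
  ∀ e : Fin k → (i : Fin m) × Fin (nb i), Function.Injective e →
    (∀ i : Fin m, (Finset.univ.filter (fun b => (e b).1 = i)).card ≤ ℓ) →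
    IsUnit (Matrix.det (Matrix.of fun a b => G a (e b)))

/-- Let `F` be a finite field with `|F| > C(mℓ, k−1)` and let
`G_C = (C_1 | … | C_m) ∈ F^{k×(mℓ)}` (blocks `C_i ∈ F^{k×ℓ}`) have every `k` of its
columns linearly independent. Then there exist `β_1, …, β_ℓ ∈ F` such that, appending to
the first block the column `d = ∑_t β_t C_1^{(t)}`, the resulting matrix
`G' = (C_1 | d | C_2 | … | C_m)` (block sizes `ℓ+1, ℓ, …, ℓ`) has every `k × k`
submatrix using at most `ℓ` columns per block invertible; i.e. its row space is an
`[mℓ+1, k, ℓ; 1, 0, …, 0]`-PMDS code. -/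
theorem pmds_step_exists (F : Type*) [Field F] [Fintype F]
    (m ℓ k : ℕ) (hm : 2 ≤ m) (hℓ : 1 ≤ ℓ) (hℓk : ℓ ≤ k) (hkm : k < m * ℓ)
    (hcard : Nat.choose (m * ℓ) (k - 1) < Fintype.card F)
    (GC : Matrix (Fin k) (Fin m × Fin ℓ) F)
    (hGC : ∀ e : Fin k → Fin m × Fin ℓ, Function.Injective e →
      IsUnit (Matrix.det (Matrix.of fun a b => GC a (e b)))) :
    ∃ β : Fin ℓ → F,
      BlockCond F ℓ (fun i => if i.1 = 0 then ℓ + 1 else ℓ)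
        (Matrix.of fun a c =>
          if h : c.2.1 < ℓ then GC a (c.1, ⟨c.2.1, h⟩)
          else ∑ t : Fin ℓ, β t * GC a (c.1, t)) := by
  classical
  let nb : Fin m → ℕ := fun i => if i.1 = 0 then ℓ + 1 else ℓ
  let i₀ : Fin m := ⟨0, by omega⟩
  have hext (x y : (i : Fin m) × Fin (nb i)) (h₁ : x.1 = y.1) (h₂ : x.2.1 = y.2.1) : x = y := by
    obtain ⟨i, a⟩ := x
    obtain ⟨j, b⟩ := y
    obtain rfl : i = j := h₁
    exact congrArg _ (Fin.ext h₂)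
  have hnew (x : (i : Fin m) × Fin (nb i)) (hx : ¬ x.2.1 < ℓ) : x.1 = i₀ ∧ x.2.1 = ℓ := by
    obtain ⟨i, a, ha⟩ := x
    have hx' : ℓ ≤ a := not_lt.1 hx
    dsimp only [nb] at ha
    split_ifs at ha with hi
    · exact ⟨Fin.ext hi, by dsimp only; omega⟩
    · omega
  obtain ⟨β, hβ⟩ := exists_sum_smul_notMem_span_image (hℓ.trans hℓk)
    (by simpa using hcard) GC.col (linearIndepOn_col_of_forall_isUnit_det hGC)
    (fun t : Fin ℓ => (i₀, t))
  refine ⟨β, fun e he hblock => ?_⟩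
  let g (b : Fin k) : Fin m × Fin ℓ := ((e b).1, if h : (e b).2.1 < ℓ then ⟨_, h⟩ else ⟨0, hℓ⟩)
  have hg (b b' : Fin k) (h : (e b).2.1 < ℓ) (h' : (e b').2.1 < ℓ) (hgg : g b = g b') :
      b = b' := by
    simp only [g, dif_pos h, dif_pos h', Prod.mk.injEq, Fin.mk.injEq] at hgg
    exact he (hext _ _ hgg.1 hgg.2)
  by_cases hold : ∀ b, (e b).2.1 < ℓ
  · convert hGC g (fun b b' => hg b b' (hold b) (hold b')) using 2
    ext a b
    simp [g, hold b]
  push Not at hold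
  obtain ⟨b₀, hb₀⟩ := hold
  obtain ⟨hi₀, hlast⟩ := hnew _ hb₀.not_gt
  have hlt (b : Fin k) (hb : b ≠ b₀) : (e b).2.1 < ℓ := by
    by_contra h
    obtain ⟨h₁, h₂⟩ := hnew _ h
    exact hb (he (hext _ _ (h₁.trans hi₀.symm) (h₂.trans hlast.symm)))
  let s : Finset (Fin m × Fin ℓ) := (Finset.univ.erase b₀).image g
  have hginj : Set.InjOn g (Finset.univ.erase b₀ : Finset (Fin k)) := fun b hb b' hb' =>
    hg b b' (hlt b (by simpa using hb)) (hlt b' (by simpa using hb'))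
  have hs : s.card = k - 1 := by
    rw [Finset.card_image_of_injOn hginj, Finset.card_erase_of_mem (Finset.mem_univ _)]
    simp
  have hmiss : ∃ t : Fin ℓ, (i₀, t) ∉ s := by
    by_contra! hall
    have hsub : Finset.univ.image (fun t : Fin ℓ => (i₀, t)) ⊆
        ((Finset.univ.filter fun b => (e b).1 = i₀).erase b₀).image g := by
      intro x hx
      obtain ⟨t, -, rfl⟩ := Finset.mem_image.1 hx
      obtain ⟨b, hb, hbt⟩ := Finset.mem_image.1 (hall t)
      refine Finset.mem_image.2 ⟨b, ?_, hbt⟩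
      simpa using ⟨by simpa using hb, congrArg Prod.fst hbt⟩
    have h₁ := (Finset.card_le_card hsub).trans Finset.card_image_le
    rw [Finset.card_image_of_injective _ (Prod.mk_right_injective i₀), Finset.card_univ,
      Fintype.card_fin, Finset.card_erase_of_mem (by simpa using hi₀)] at h₁
    have h₂ := hblock i₀
    omega
  rw [← Matrix.isUnit_iff_isUnit_det, ← Matrix.linearIndependent_cols_iff_isUnit]
  set w := Matrix.col (Matrix.of fun a b =>
    (Matrix.of fun (a : Fin k) (c : (i : Fin m) × Fin (nb i)) =>
      if h : c.2.1 < ℓ then GC a (c.1, ⟨c.2.1, h⟩) else ∑ t : Fin ℓ, β t * GC a (c.1, t))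
      a (e b)) with hw
  have hwg (b : Fin k) (hb : b ≠ b₀) : w b = GC.col (g b) := by
    ext a
    simp [hw, g, hlt b hb]
  have hw₀ : w b₀ = ∑ t, β t • GC.col (i₀, t) := by
    ext a
    simp [hw, hlast, hi₀, Finset.sum_apply]
  obtain ⟨t, ht⟩ := hmiss
  have hind : LinearIndepOn F GC.col (s : Set (Fin m × Fin ℓ)) :=
    (linearIndepOn_col_of_forall_isUnit_det hGC (insert (i₀, t) s)
      (by rw [Finset.card_insert_of_notMem ht]; omega)).mono (by simp)
  rw [Finset.coe_image] at hind
  have hwg' : Set.EqOn (GC.col ∘ g) w (Finset.univ.erase b₀ : Finset (Fin k)) :=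
    fun b hb => (hwg b (by simpa using hb)).symm
  have huniv : insert b₀ ((Finset.univ.erase b₀ : Finset (Fin k)) : Set (Fin k)) = Set.univ := by
    rw [← Finset.coe_insert, Finset.insert_erase (Finset.mem_univ _), Finset.coe_univ]
  rw [← linearIndepOn_univ_iff, ← huniv, linearIndepOn_insert (by simp)]
  refine ⟨(hind.comp_of_image hginj).congr hwg', ?_⟩
  rw [← hwg'.image_eq, Set.image_comp, ← Finset.coe_image, hw₀]
  exact hβ s hs ⟨t, ht⟩
end
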